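/- arXiv:math/0405383 — 2 statements merged into one kernel-verified Lean document; each statement's English description precedes it below -/
import Mathlib

section
/- Suppose k_j = k_{j'} whenever j ≡ j' + 2 (mod d). Define ℂ-linear operators on ℂ[Z,W]: H(f) = Z·D_Z(f) + W·D_W(f) + f − Σ_{j=1}^d k_j·σ_j(f), E(f) = (1/2)·Z·W·f, and F(f) = −2·D_Z(D_W(f)). Then (E, H, F) is an sl₂-triple of operators: H∘E − E∘H = 2E, H∘F − F∘H = −2F, and E∘F − F∘E = H. -/
open MvPolynomial
open scoped Classical

noncomputable section

/-- The polynomial ring `ℂ[Z,W]`, with `Z = X 0` and `W = X 1`. -/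
abbrev R2 : Type := MvPolynomial (Fin 2) ℂ

/-- `ζ = exp(2πi/d)`. -/
def zeta (d : ℕ) : ℂ := Complex.exp (2 * Real.pi * Complex.I / d)

/-- The action of the reflection `s_j` of `I₂(d)` on `ℂ[Z,W]`:
`Z ↦ ζ^j·W`, `W ↦ ζ^{-j}·Z`. -/
def reflAct (d j : ℕ) : R2 →ₐ[ℂ] R2 :=
  aeval ![C (zeta d ^ j) * X 1, C ((zeta d ^ j)⁻¹) * X 0]

/-- Exact division: if `a ∣ b` in `ℂ[Z,W]` this is the (unique, when `a ≠ 0`)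
quotient, and `0` otherwise. -/
def exQuot (a b : R2) : R2 := if h : ∃ c, b = a * c then Classical.choose h else 0

/-- The Dunkl operator `D_Z` with parameters `k₁,…,k_d`. -/
def DZ (d : ℕ) (k : ℕ → ℂ) (f : R2) : R2 :=
  pderiv (0 : Fin 2) f - ∑ j ∈ Finset.Icc 1 d,
    C (k j) * exQuot (X 0 - C (zeta d ^ j) * X 1) (f - reflAct d j f)

/-- The Dunkl operator `D_W` with parameters `k₁,…,k_d`. -/
def DW (d : ℕ) (k : ℕ → ℂ) (f : R2) : R2 :=
  pderiv (1 : Fin 2) f - ∑ j ∈ Finset.Icc 1 d,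
    C (k j) * exQuot (X 1 - C ((zeta d ^ j)⁻¹) * X 0) (f - reflAct d j f)

/-- The Euler operator `Z·∂_Z + W·∂_W`. -/
def eulerOp (f : R2) : R2 := X 0 * pderiv 0 f + X 1 * pderiv 1 f

/-- The Dunkl operator along the coordinate `i`, with the linear forms `a j` as denominators. -/
def dunklOp (i : Fin 2) (a : ℕ → R2) (d : ℕ) (k : ℕ → ℂ) (f : R2) : R2 :=
  pderiv i f - ∑ j ∈ Finset.Icc 1 d, C (k j) * exQuot (a j) (f - reflAct d j f)

/-- The denominators of `D_Z`. -/
def formZ (d j : ℕ) : R2 := X 0 - C (zeta d ^ j) * X 1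

/-- The denominators of `D_W`. -/
def formW (d j : ℕ) : R2 := X 1 - C ((zeta d ^ j)⁻¹) * X 0

theorem DZ_eq_dunklOp (d : ℕ) (k : ℕ → ℂ) (f : R2) :
    DZ d k f = dunklOp 0 (formZ d) d k f := rfl

theorem DW_eq_dunklOp (d : ℕ) (k : ℕ → ℂ) (f : R2) :
    DW d k f = dunklOp 1 (formW d) d k f := rfl

theorem zeta_pow_ne_zero (d j : ℕ) : zeta d ^ j ≠ 0 :=
  pow_ne_zero _ (Complex.exp_ne_zero _)

theorem C_zeta_mul_inv (d j : ℕ) :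
    (C (zeta d ^ j) * C ((zeta d ^ j)⁻¹) : R2) = 1 := by
  rw [← C_mul, mul_inv_cancel₀ (zeta_pow_ne_zero d j), C_1]

@[simp]
theorem reflAct_X_zero (d j : ℕ) : reflAct d j (X 0) = C (zeta d ^ j) * X 1 := by
  simp [reflAct]

@[simp]
theorem reflAct_X_one (d j : ℕ) : reflAct d j (X 1) = C ((zeta d ^ j)⁻¹) * X 0 := by
  simp [reflAct]

@[simp]
theorem reflAct_C (d j : ℕ) (c : ℂ) : reflAct d j (C c) = C c := by
  simp [reflAct]

theorem exQuot_eq {a b c : R2} (ha : a ≠ 0) (h : b = a * c) : exQuot a b = c := by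
  have hex : ∃ c, b = a * c := ⟨c, h⟩
  rw [exQuot, dif_pos hex]
  exact mul_left_cancel₀ ha ((Classical.choose_spec hex).symm.trans h)

theorem mul_exQuot {a b : R2} (h : a ∣ b) : a * exQuot a b = b := by
  have hex : ∃ c, b = a * c := h
  rw [exQuot, dif_pos hex]
  exact (Classical.choose_spec hex).symm

theorem formW_eq (d j : ℕ) : formW d j = -C ((zeta d ^ j)⁻¹) * formZ d j := by
  rw [formW, formZ]
  linear_combination -X 1 * C_zeta_mul_inv d j

theorem formZ_eq (d j : ℕ) : formZ d j = -C (zeta d ^ j) * formW d j := by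
  rw [formW, formZ]
  linear_combination -X 0 * C_zeta_mul_inv d j

theorem formZ_ne_zero (d j : ℕ) : formZ d j ≠ 0 := by
  intro h
  have := congrArg (eval ![1, 0]) h
  simp [formZ] at this

theorem formW_ne_zero (d j : ℕ) : formW d j ≠ 0 := by
  intro h
  have := congrArg (eval ![0, 1]) h
  simp [formW] at this

theorem formZ_dvd (d j : ℕ) (f : R2) : formZ d j ∣ f - reflAct d j f := by
  induction f using MvPolynomial.induction_on with
  | C c => simp
  | add p q hp hq =>
    rw [map_add, add_sub_add_comm]
    exact dvd_add hp hq
  | mul_X p i hp =>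
    have hX : formZ d j ∣ X i - reflAct d j (X i) := by
      fin_cases i
      · exact Dvd.intro 1 (by simp [formZ])
      · refine Dvd.intro_left (-C ((zeta d ^ j)⁻¹)) ?_
        simpa [formW] using (formW_eq d j).symm
    have h : p * X i - reflAct d j (p * X i)
        = (p - reflAct d j p) * X i + reflAct d j p * (X i - reflAct d j (X i)) := by
      rw [map_mul]; ring
    rw [h]
    exact dvd_add (hp.mul_right _) (hX.mul_left _)

theorem formW_dvd (d j : ℕ) (f : R2) : formW d j ∣ f - reflAct d j f :=
  (Dvd.intro_left _ (formZ_eq d j).symm).trans (formZ_dvd d j f)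

theorem eulerOp_add (f g : R2) : eulerOp (f + g) = eulerOp f + eulerOp g := by
  simp only [eulerOp, map_add]; ring

theorem eulerOp_mul (f g : R2) : eulerOp (f * g) = eulerOp f * g + f * eulerOp g := by
  simp only [eulerOp, Derivation.leibniz, smul_eq_mul]; ring

@[simp]
theorem eulerOp_C (c : ℂ) : eulerOp (C c) = 0 := by
  simp [eulerOp]

@[simp]
theorem eulerOp_X (i : Fin 2) : eulerOp (X i) = X i := by
  fin_cases i <;> simp [eulerOp, pderiv_X]

theorem eulerOp_C_mul (c : ℂ) (f : R2) : eulerOp (C c * f) = C c * eulerOp f := by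
  simp [eulerOp_mul]

theorem eulerOp_sub (f g : R2) : eulerOp (f - g) = eulerOp f - eulerOp g := by
  simp only [eulerOp, map_sub]; ring

theorem eulerOp_sum {ι : Type*} (s : Finset ι) (f : ι → R2) :
    eulerOp (∑ j ∈ s, f j) = ∑ j ∈ s, eulerOp (f j) := by
  simp only [eulerOp, map_sum, Finset.mul_sum, Finset.sum_add_distrib]

theorem eulerOp_formZ (d j : ℕ) : eulerOp (formZ d j) = formZ d j := by
  rw [formZ, eulerOp_sub, eulerOp_C_mul, eulerOp_X, eulerOp_X]

theorem eulerOp_formW (d j : ℕ) : eulerOp (formW d j) = formW d j := by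
  rw [formW, eulerOp_sub, eulerOp_C_mul, eulerOp_X, eulerOp_X]

theorem eulerOp_reflAct (d j : ℕ) (f : R2) :
    eulerOp (reflAct d j f) = reflAct d j (eulerOp f) := by
  induction f using MvPolynomial.induction_on with
  | C c => simp
  | add p q hp hq => simp only [map_add, eulerOp_add, hp, hq]
  | mul_X p i hp =>
    have hX : eulerOp (reflAct d j (X i)) = reflAct d j (X i) := by
      fin_cases i <;> simp [eulerOp_C_mul, -map_pow, -C_pow]
    simp only [map_mul, map_add, eulerOp_mul, hp, hX, eulerOp_X]

theorem pderiv_eulerOp (i : Fin 2) (f : R2) :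
    pderiv i (eulerOp f) = eulerOp (pderiv i f) + pderiv i f := by
  induction f using MvPolynomial.induction_on with
  | C c => simp [eulerOp]
  | add p q hp hq => simp only [map_add, eulerOp_add, hp, hq]; ring
  | mul_X p l hp =>
    have hX : eulerOp (pderiv i (X l : R2)) = 0 := by
      rw [pderiv_X]
      by_cases h : l = i
      · subst h
        simpa using eulerOp_C 1
      · simpa [h] using eulerOp_C 0
    simp only [eulerOp_mul, eulerOp_add, eulerOp_X, Derivation.leibniz, smul_eq_mul, map_add,
      hp, hX]
    ring

section dunklOp

variable {a : ℕ → R2} {d : ℕ} (i : Fin 2) (k : ℕ → ℂ)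

theorem dunklOp_add (ha : ∀ j, a j ≠ 0) (hdvd : ∀ j f, a j ∣ f - reflAct d j f) (f g : R2) :
    dunklOp i a d k (f + g) = dunklOp i a d k f + dunklOp i a d k g := by
  have h (j : ℕ) : exQuot (a j) (f + g - reflAct d j (f + g))
      = exQuot (a j) (f - reflAct d j f) + exQuot (a j) (g - reflAct d j g) := by
    refine exQuot_eq (ha j) ?_
    rw [mul_add, mul_exQuot (hdvd j f), mul_exQuot (hdvd j g), map_add]
    ring
  simp only [dunklOp, h, mul_add, Finset.sum_add_distrib]
  rw [map_add]
  ring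

/-- The twisted Leibniz rule for Dunkl operators. -/
theorem dunklOp_mul (ha : ∀ j, a j ≠ 0) (hdvd : ∀ j f, a j ∣ f - reflAct d j f) (g f : R2) :
    dunklOp i a d k (g * f) = g * dunklOp i a d k f + pderiv i g * f
      - ∑ j ∈ Finset.Icc 1 d, C (k j) * (exQuot (a j) (g - reflAct d j g) * reflAct d j f) := by
  have h (j : ℕ) : exQuot (a j) (g * f - reflAct d j (g * f))
      = g * exQuot (a j) (f - reflAct d j f)
        + exQuot (a j) (g - reflAct d j g) * reflAct d j f := by
    refine exQuot_eq (ha j) ?_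
    rw [map_mul]
    linear_combination -g * mul_exQuot (hdvd j f) - reflAct d j f * mul_exQuot (hdvd j g)
  simp only [dunklOp, h, Derivation.leibniz, smul_eq_mul, mul_add, Finset.sum_add_distrib,
    mul_sub, Finset.mul_sum, mul_left_comm g]
  ring

theorem dunklOp_mul_of_invariant (ha : ∀ j, a j ≠ 0) (hdvd : ∀ j f, a j ∣ f - reflAct d j f)
    {g : R2} (hg : ∀ j, reflAct d j g = g) (f : R2) :
    dunklOp i a d k (g * f) = g * dunklOp i a d k f + pderiv i g * f := by
  have h (j : ℕ) : exQuot (a j) (g - reflAct d j g) = 0 := exQuot_eq (ha j) (by simp [hg])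
  simp [dunklOp_mul i k ha hdvd, h]

theorem dunklOp_C_mul (ha : ∀ j, a j ≠ 0) (hdvd : ∀ j f, a j ∣ f - reflAct d j f)
    (c : ℂ) (f : R2) : dunklOp i a d k (C c * f) = C c * dunklOp i a d k f := by
  simp [dunklOp_mul_of_invariant i k ha hdvd (fun j => reflAct_C d j c)]

/-- Dunkl operators lower the degree by one. -/
theorem dunklOp_eulerOp (ha : ∀ j, a j ≠ 0) (hdvd : ∀ j f, a j ∣ f - reflAct d j f)
    (hdeg : ∀ j, eulerOp (a j) = a j) (f : R2) :
    dunklOp i a d k (eulerOp f) = eulerOp (dunklOp i a d k f) + dunklOp i a d k f := by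
  have h (j : ℕ) : exQuot (a j) (eulerOp f - reflAct d j (eulerOp f))
      = eulerOp (exQuot (a j) (f - reflAct d j f)) + exQuot (a j) (f - reflAct d j f) := by
    refine exQuot_eq (ha j) ?_
    have hq := congrArg eulerOp (mul_exQuot (hdvd j f))
    rw [eulerOp_mul, hdeg, eulerOp_sub, eulerOp_reflAct] at hq
    rw [← hq]
    ring
  simp only [dunklOp, h, pderiv_eulerOp, eulerOp_sub, eulerOp_sum, eulerOp_C_mul, mul_add,
    Finset.sum_add_distrib]
  ring

end dunklOp

theorem X_mul_DZ_add_X_mul_DW (d : ℕ) (k : ℕ → ℂ) (f : R2) :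
    X 0 * DZ d k f + X 1 * DW d k f
      = eulerOp f - ∑ j ∈ Finset.Icc 1 d, C (k j) * (f - reflAct d j f) := by
  have h (j : ℕ) : X 0 * exQuot (formZ d j) (f - reflAct d j f)
      + X 1 * exQuot (formW d j) (f - reflAct d j f) = f - reflAct d j f := by
    have hW : exQuot (formW d j) (f - reflAct d j f)
        = -C (zeta d ^ j) * exQuot (formZ d j) (f - reflAct d j f) := by
      refine exQuot_eq (formW_ne_zero d j) ?_
      rw [mul_left_comm, ← mul_assoc, ← formZ_eq, mul_exQuot (formZ_dvd d j f)]
    have hZ := mul_exQuot (formZ_dvd d j f)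
    rw [hW]
    nth_rewrite 3 [← hZ]
    rw [formZ]
    ring
  have hsum : ∑ j ∈ Finset.Icc 1 d, C (k j) * (f - reflAct d j f)
      = X 0 * ∑ j ∈ Finset.Icc 1 d, C (k j) * exQuot (formZ d j) (f - reflAct d j f)
        + X 1 * ∑ j ∈ Finset.Icc 1 d, C (k j) * exQuot (formW d j) (f - reflAct d j f) := by
    rw [Finset.mul_sum, Finset.mul_sum, ← Finset.sum_add_distrib]
    refine Finset.sum_congr rfl fun j _ => ?_
    linear_combination -C (k j) * h j
  rw [hsum, DZ_eq_dunklOp, DW_eq_dunklOp, dunklOp, dunklOp, eulerOp]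
  ring

theorem reflAct_X_mul_X (d j : ℕ) : reflAct d j (X 0 * X 1) = X 0 * X 1 := by
  rw [map_mul, reflAct_X_zero, reflAct_X_one]
  linear_combination X 0 * X 1 * C_zeta_mul_inv d j

theorem DZ_X_mul (d : ℕ) (k : ℕ → ℂ) (f : R2) :
    DZ d k (X 0 * f) = X 0 * DZ d k f + f - ∑ j ∈ Finset.Icc 1 d, C (k j) * reflAct d j f := by
  have h (j : ℕ) : exQuot (formZ d j) (X 0 - reflAct d j (X 0)) = 1 :=
    exQuot_eq (formZ_ne_zero d j) (by simp [formZ])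
  simp only [DZ_eq_dunklOp, dunklOp_mul 0 k (formZ_ne_zero d) (formZ_dvd d), h, pderiv_X_self,
    one_mul]

theorem DZ_X_mul_X_mul (d : ℕ) (k : ℕ → ℂ) (f : R2) :
    DZ d k (X 0 * X 1 * f) = X 0 * X 1 * DZ d k f + X 1 * f := by
  rw [DZ_eq_dunklOp, dunklOp_mul_of_invariant 0 k (formZ_ne_zero d) (formZ_dvd d)
    (fun j => reflAct_X_mul_X d j)]
  simp [DZ_eq_dunklOp, pderiv_X]

theorem DW_X_mul_X_mul (d : ℕ) (k : ℕ → ℂ) (f : R2) :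
    DW d k (X 0 * X 1 * f) = X 0 * X 1 * DW d k f + X 0 * f := by
  rw [DW_eq_dunklOp, dunklOp_mul_of_invariant 1 k (formW_ne_zero d) (formW_dvd d)
    (fun j => reflAct_X_mul_X d j)]
  simp [DW_eq_dunklOp, pderiv_X]

theorem DZ_add (d : ℕ) (k : ℕ → ℂ) (f g : R2) : DZ d k (f + g) = DZ d k f + DZ d k g :=
  dunklOp_add 0 k (formZ_ne_zero d) (formZ_dvd d) f g

theorem DW_add (d : ℕ) (k : ℕ → ℂ) (f g : R2) : DW d k (f + g) = DW d k f + DW d k g :=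
  dunklOp_add 1 k (formW_ne_zero d) (formW_dvd d) f g

theorem DZ_C_mul (d : ℕ) (k : ℕ → ℂ) (c : ℂ) (f : R2) : DZ d k (C c * f) = C c * DZ d k f :=
  dunklOp_C_mul 0 k (formZ_ne_zero d) (formZ_dvd d) c f

theorem DW_C_mul (d : ℕ) (k : ℕ → ℂ) (c : ℂ) (f : R2) : DW d k (C c * f) = C c * DW d k f :=
  dunklOp_C_mul 1 k (formW_ne_zero d) (formW_dvd d) c f

theorem DZ_eulerOp (d : ℕ) (k : ℕ → ℂ) (f : R2) :
    DZ d k (eulerOp f) = eulerOp (DZ d k f) + DZ d k f :=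
  dunklOp_eulerOp 0 k (formZ_ne_zero d) (formZ_dvd d) (eulerOp_formZ d) f

theorem DW_eulerOp (d : ℕ) (k : ℕ → ℂ) (f : R2) :
    DW d k (eulerOp f) = eulerOp (DW d k f) + DW d k f :=
  dunklOp_eulerOp 1 k (formW_ne_zero d) (formW_dvd d) (eulerOp_formW d) f

/-- With conjugation-invariant parameters, the operators `E`, `H`, `F` form an
`sl₂`-triple on `ℂ[Z,W]`. -/
theorem sl2_triple (d : ℕ) (hd : 3 ≤ d) (k : ℕ → ℂ)
    (hk : ∀ j j', j ∈ Finset.Icc 1 d → j' ∈ Finset.Icc 1 d →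
      (j : ZMod d) = (j' : ZMod d) + 2 → k j = k j')
    (H E F : R2 → R2)
    (hH : ∀ f, H f = X 0 * DZ d k f + X 1 * DW d k f + f
        - ∑ j ∈ Finset.Icc 1 d, C (k j) * reflAct d j f)
    (hE : ∀ f, E f = C (1/2) * (X 0 * X 1 * f))
    (hF : ∀ f, F f = -2 * DZ d k (DW d k f)) :
    (∀ f, H (E f) - E (H f) = 2 * E f) ∧
    (∀ f, H (F f) - F (H f) = -2 * F f) ∧
    (∀ f, E (F f) - F (E f) = H f) := by
  have hH' (f : R2) : H f = eulerOp f + C (1 - ∑ j ∈ Finset.Icc 1 d, k j) * f := by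
    rw [hH, X_mul_DZ_add_X_mul_DW]
    simp only [map_sub, map_sum, C_1, mul_sub, Finset.sum_sub_distrib, sub_mul, Finset.sum_mul]
    ring
  have hC : (C (1 / 2) * 2 : R2) = 1 := by
    rw [show (2 : R2) = C 2 from (map_ofNat C 2).symm, ← C_mul]
    norm_num
  refine ⟨fun f => ?_, fun f => ?_, fun f => ?_⟩
  · rw [hH', hH', hE, hE, eulerOp_C_mul, eulerOp_mul, eulerOp_mul, eulerOp_X, eulerOp_X]
    ring
  · have h2 : (-2 : R2) = C (-2) := by rw [map_neg, map_ofNat]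
    rw [hH', hH', hF, hF, h2, eulerOp_C_mul, DW_add, DW_C_mul, DW_eulerOp, DZ_add, DZ_C_mul,
      DZ_add, DZ_eulerOp, ← h2]
    ring
  · rw [hH, hF, hF, hE, hE, DW_C_mul, DZ_C_mul, DW_X_mul_X_mul, DZ_add, DZ_X_mul_X_mul, DZ_X_mul]
    linear_combination (X 0 * DZ d k f + X 1 * DW d k f + f
      - ∑ j ∈ Finset.Icc 1 d, C (k j) * reflAct d j f) * hC

end
end

section
/- Let d = 2m+1 be odd and let the parameter function be constant, k_j = c for all j. For every integer n ≥ 0, the polynomial f = (Z^d − W^d)^{2n+1} is singular (i.e. D_Z(f) = 0 and D_W(f) = 0) if and only if c = n + 1/2. Moreover σ_j(f) = −f for every j, so f spans a copy of the sign representation of I₂(d). -/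
open MvPolynomial
open scoped Classical

noncomputable section

/-- Exact division recovers the cofactor. -/
theorem exQuot_eq_of_eq_mul {a b q : R2} (ha : a ≠ 0) (h : b = a * q) : exQuot a b = q := by
  have hex : ∃ c, b = a * c := ⟨q, h⟩
  rw [exQuot, dif_pos hex]
  exact mul_left_cancel₀ ha ((Classical.choose_spec hex).symm.trans h)

theorem zeta_ne_zero (d : ℕ) : zeta d ≠ 0 := Complex.exp_ne_zero _

theorem zeta_isPrimitiveRoot {d : ℕ} (hd : d ≠ 0) : IsPrimitiveRoot (zeta d) d :=
  Complex.isPrimitiveRoot_exp d hd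

theorem zeta_pow_pow {d : ℕ} (hd : d ≠ 0) (j : ℕ) : (zeta d ^ j) ^ d = 1 := by
  rw [pow_right_comm, (zeta_isPrimitiveRoot hd).pow_eq_one, one_pow]

theorem X_zero_sub_C_mul_X_one_ne_zero (a : ℂ) : (X 0 - C a * X 1 : R2) ≠ 0 := by
  intro h
  simpa using congrArg (eval ![1, 0]) h

theorem X_one_sub_C_mul_X_zero_ne_zero (a : ℂ) : (X 1 - C a * X 0 : R2) ≠ 0 := by
  intro h
  simpa using congrArg (eval ![0, 1]) h

/-- The factorisation of `Z^d - W^d` into the linear forms `Z - ζ^j W`. -/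
theorem X_pow_sub_X_pow_eq_prod {d : ℕ} (hd : d ≠ 0) :
    (X 0 ^ d - X 1 ^ d : R2) = ∏ j ∈ Finset.Icc 1 d, (X 0 - C (zeta d ^ j) * X 1) := by
  have hprim : IsPrimitiveRoot (C (zeta d) : R2) d :=
    (zeta_isPrimitiveRoot hd).map_of_injective (C_injective _ _)
  have hinj : Set.InjOn (fun j => (C (zeta d) : R2) ^ j) (Finset.Icc 1 d) := by
    intro i hi j hj hij
    rw [Finset.coe_Icc, Set.mem_Icc] at hi hj
    have hu : IsUnit (C (zeta d) : R2) := hprim.isUnit hd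
    obtain ⟨i, rfl⟩ := Nat.exists_eq_add_of_le hi.1
    obtain ⟨j, rfl⟩ := Nat.exists_eq_add_of_le hj.1
    have : (C (zeta d) : R2) ^ i = C (zeta d) ^ j := by
      simpa [pow_add, hu.mul_right_inj] using hij
    rw [hprim.pow_inj (by lia) (by lia) this]
  have himage : (Finset.Icc 1 d).image (fun j => (C (zeta d) : R2) ^ j) =
      Polynomial.nthRootsFinset d 1 := by
    apply Finset.eq_of_subset_of_card_le
    · intro x hx
      obtain ⟨j, -, rfl⟩ := Finset.mem_image.mp hx
      rw [Polynomial.mem_nthRootsFinset (Nat.pos_of_ne_zero hd), pow_right_comm,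
        hprim.pow_eq_one, one_pow]
    · rw [Finset.card_image_of_injOn hinj, hprim.card_nthRootsFinset, Nat.card_Icc,
        Nat.add_sub_cancel]
  rw [hprim.pow_sub_pow_eq_prod_sub_mul _ _ (Nat.pos_of_ne_zero hd), ← himage,
    Finset.prod_image hinj]
  simp only [map_pow]

theorem reflAct_X_pow_sub_X_pow {d : ℕ} (hd : d ≠ 0) (j : ℕ) :
    reflAct d j (X 0 ^ d - X 1 ^ d) = -(X 0 ^ d - X 1 ^ d) := by
  have hpow (a : ℂ) (x : R2) (ha : a ^ d = 1) : (C a * x) ^ d = x ^ d := by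
    rw [mul_pow, ← C_pow, ha, C_1, one_mul]
  have hinv : ((zeta d ^ j)⁻¹) ^ d = 1 := by rw [inv_pow, zeta_pow_pow hd, inv_one]
  rw [map_sub, map_pow, map_pow, reflAct, aeval_X, aeval_X, neg_sub]
  exact congrArg₂ _ (hpow _ _ (zeta_pow_pow hd j)) (hpow _ _ hinv)

theorem reflAct_odd_pow {d : ℕ} (hd : d ≠ 0) (n j : ℕ) :
    reflAct d j ((X 0 ^ d - X 1 ^ d) ^ (2 * n + 1)) = -(X 0 ^ d - X 1 ^ d) ^ (2 * n + 1) := by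
  rw [map_pow, reflAct_X_pow_sub_X_pow hd, Odd.neg_pow ⟨n, rfl⟩]

/-- The Leibniz rule for a finite product. -/
theorem derivation_prod {ι A B : Type*} [DecidableEq ι] [CommSemiring A] [CommSemiring B]
    [Algebra A B] (D : Derivation A B B) (s : Finset ι) (g : ι → B) :
    D (∏ i ∈ s, g i) = ∑ j ∈ s, (∏ i ∈ s.erase j, g i) * D (g j) := by
  induction s using Finset.induction_on with
  | empty => simp
  | insert a s ha ih =>
    rw [Finset.prod_insert ha, D.leibniz, ih, Finset.sum_insert ha, Finset.erase_insert ha,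
      add_comm, smul_eq_mul, smul_eq_mul, Finset.mul_sum]
    congr 1
    refine Finset.sum_congr rfl fun j hj => ?_
    rw [Finset.erase_insert_of_ne (ne_of_mem_of_not_mem hj ha).symm,
      Finset.prod_insert fun h => ha (Finset.mem_of_mem_erase h), mul_assoc]

/-- A derivation applied to `Z^d - W^d`, expanded over its linear factors. -/
theorem derivation_X_pow_sub_X_pow {d : ℕ} (hd : d ≠ 0) (D : Derivation ℂ R2 R2) :
    D (X 0 ^ d - X 1 ^ d) = ∑ j ∈ Finset.Icc 1 d,
      (∏ i ∈ (Finset.Icc 1 d).erase j, (X 0 - C (zeta d ^ i) * X 1)) *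
        D (X 0 - C (zeta d ^ j) * X 1) := by
  rw [X_pow_sub_X_pow_eq_prod hd, derivation_prod]

/-- If each linear form `ℓ j` in the denominator of a Dunkl operator is proportional to the form
`Z - ζ^j W`, normalised by `D`, then that operator acts on odd powers of `Z^d - W^d` as a multiple
of `D`. -/
theorem derivation_sub_sum_exQuot {d : ℕ} (hd : d ≠ 0) (n : ℕ) (c : ℂ)
    (D : Derivation ℂ R2 R2) (ℓ : ℕ → R2) (hℓ : ∀ j, ℓ j ≠ 0)
    (hD : ∀ j, ℓ j * D (X 0 - C (zeta d ^ j) * X 1) = X 0 - C (zeta d ^ j) * X 1) :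
    let f : R2 := (X 0 ^ d - X 1 ^ d) ^ (2 * n + 1)
    D f - ∑ j ∈ Finset.Icc 1 d, C c * exQuot (ℓ j) (f - reflAct d j f) =
      C (2 * n + 1 - 2 * c) * ((X 0 ^ d - X 1 ^ d) ^ (2 * n) * D (X 0 ^ d - X 1 ^ d)) := by
  intro f
  have hquot : ∀ j ∈ Finset.Icc 1 d, C c * exQuot (ℓ j) (f - reflAct d j f) =
      C (2 * c) * (X 0 ^ d - X 1 ^ d) ^ (2 * n) *
        ((∏ i ∈ (Finset.Icc 1 d).erase j, (X 0 - C (zeta d ^ i) * X 1)) *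
          D (X 0 - C (zeta d ^ j) * X 1)) := by
    intro j hj
    rw [exQuot_eq_of_eq_mul (hℓ j) (q := 2 * (X 0 ^ d - X 1 ^ d) ^ (2 * n) *
        ((∏ i ∈ (Finset.Icc 1 d).erase j, (X 0 - C (zeta d ^ i) * X 1)) *
          D (X 0 - C (zeta d ^ j) * X 1)))]
    · rw [C_mul, show (C 2 : R2) = 2 from map_ofNat C 2]
      ring
    · have hP : (X 0 ^ d - X 1 ^ d : R2) =
          (ℓ j * D (X 0 - C (zeta d ^ j) * X 1)) *
            ∏ i ∈ (Finset.Icc 1 d).erase j, (X 0 - C (zeta d ^ i) * X 1) := by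
        rw [hD, Finset.mul_prod_erase _ (fun i => (X 0 - C (zeta d ^ i) * X 1 : R2)) hj,
          X_pow_sub_X_pow_eq_prod hd]
      rw [reflAct_odd_pow hd, sub_neg_eq_add, ← two_mul]
      simp only [f, pow_succ]
      linear_combination 2 * (X 0 ^ d - X 1 ^ d) ^ (2 * n) * hP
  rw [Finset.sum_congr rfl hquot, ← Finset.mul_sum, ← derivation_X_pow_sub_X_pow hd,
    Derivation.leibniz_pow, Nat.add_sub_cancel, nsmul_eq_mul, smul_eq_mul]
  simp only [C_sub, C_add, C_mul, C_1, map_natCast, map_ofNat, Nat.cast_add, Nat.cast_mul,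
    Nat.cast_ofNat, Nat.cast_one]
  ring

theorem X_pow_sub_X_pow_ne_zero {d : ℕ} (hd : d ≠ 0) : (X 0 ^ d - X 1 ^ d : R2) ≠ 0 := by
  rw [X_pow_sub_X_pow_eq_prod hd]
  exact Finset.prod_ne_zero_iff.mpr fun j _ => X_zero_sub_C_mul_X_one_ne_zero _

theorem DZ_odd_pow {d : ℕ} (hd : d ≠ 0) (n : ℕ) (c : ℂ) :
    DZ d (fun _ => c) ((X 0 ^ d - X 1 ^ d) ^ (2 * n + 1)) =
      C (2 * n + 1 - 2 * c) *
        ((X 0 ^ d - X 1 ^ d) ^ (2 * n) * pderiv 0 (X 0 ^ d - X 1 ^ d)) := by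
  refine derivation_sub_sum_exQuot hd n c (pderiv 0) _
    (fun j => X_zero_sub_C_mul_X_one_ne_zero _) fun j => ?_
  simp [pderiv_X, -map_pow]

theorem DW_odd_pow {d : ℕ} (hd : d ≠ 0) (n : ℕ) (c : ℂ) :
    DW d (fun _ => c) ((X 0 ^ d - X 1 ^ d) ^ (2 * n + 1)) =
      C (2 * n + 1 - 2 * c) *
        ((X 0 ^ d - X 1 ^ d) ^ (2 * n) * pderiv 1 (X 0 ^ d - X 1 ^ d)) := by
  refine derivation_sub_sum_exQuot hd n c (pderiv 1) _
    (fun j => X_one_sub_C_mul_X_zero_ne_zero _) fun j => ?_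
  have hC : (C ((zeta d ^ j)⁻¹) * C (zeta d ^ j) : R2) = 1 := by
    rw [← C_mul, inv_mul_cancel₀ (pow_ne_zero _ (zeta_ne_zero d)), C_1]
  have hder : pderiv 1 (X 0 - C (zeta d ^ j) * X 1 : R2) = -C (zeta d ^ j) := by
    simp [pderiv_X, -map_pow]
  rw [hder]
  linear_combination X 0 * hC

/-- For odd `d = 2m+1` and constant parameter `c`, the polynomial
`f = (Z^d − W^d)^{2n+1}` is singular iff `c = n + 1/2`; moreover `σ_j(f) = −f`
for every reflection `s_j`, so `f` spans a copy of the sign representation. -/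
theorem odd_sgn_singular (m n : ℕ) (hm : 1 ≤ m) (c : ℂ) (f : R2)
    (hf : f = ((X 0 : R2) ^ (2 * m + 1) - X 1 ^ (2 * m + 1)) ^ (2 * n + 1)) :
    ((DZ (2 * m + 1) (fun _ => c) f = 0 ∧ DW (2 * m + 1) (fun _ => c) f = 0) ↔
        c = (n : ℂ) + 1 / 2) ∧
    ∀ j ∈ Finset.Icc 1 (2 * m + 1), reflAct (2 * m + 1) j f = -f := by
  have hd : 2 * m + 1 ≠ 0 := by lia
  subst hf
  refine ⟨?_, fun j _ => reflAct_odd_pow hd n j⟩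
  rw [DZ_odd_pow hd, DW_odd_pow hd]
  constructor
  · rintro ⟨h, -⟩
    have hder : pderiv 0 (X 0 ^ (2 * m + 1) - X 1 ^ (2 * m + 1) : R2) ≠ 0 := by
      intro h0
      have h1 : 2 * (m : ℂ) + 1 = 0 := by
        simpa [pderiv_X] using congrArg (eval ![1, 0]) h0
      exact hd (by exact_mod_cast h1)
    have hC := (mul_eq_zero.mp h).resolve_right
      (mul_ne_zero (pow_ne_zero _ (X_pow_sub_X_pow_ne_zero hd)) hder)
    rw [C_eq_zero] at hC
    linear_combination -hC / 2
  · rintro rfl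
    rw [show (2 * n + 1 - 2 * (n + 1 / 2) : ℂ) = 0 by ring, C_0, zero_mul, zero_mul]
    exact ⟨rfl, rfl⟩

end
end
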